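/- arXiv:math/0507327 — 3 statements merged into one kernel-verified Lean document; each statement's English description precedes it below -/
import Mathlib

section
/- Let T > 0. Suppose α and β are locally integrable real-valued functions on (0,∞) such that liminf_{t→∞} (1/T)∫_t^{t+T} α(τ) dτ = γ for some γ > 0, limsup_{t→∞} (1/T)∫_t^{t+T} α⁻(τ) dτ = Γ for some Γ < ∞ (where α⁻ = max{−α, 0}), and lim_{t→∞} (1/T)∫_t^{t+T} β⁺(τ) dτ = 0 (where β⁺ = max{β, 0}). If ξ is a nonnegative, locally absolutely continuous function on (0,∞) satisfying ξ'(t) + α(t)ξ(t) ≤ β(t) for almost every t ∈ (0,∞), then ξ(t) → 0 as t → ∞. -/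
open MeasureTheory Filter

open Set Topology

theorem LipschitzOnWith.comp_absolutelyContinuousOnInterval {X Y : Type*} [PseudoMetricSpace X]
    [PseudoMetricSpace Y] {g : X → Y} {f : ℝ → X} {s : Set X} {K : NNReal} {a b : ℝ}
    (hg : LipschitzOnWith K g s) (hf : AbsolutelyContinuousOnInterval f a b)
    (hs : MapsTo f (uIcc a b) s) :
    AbsolutelyContinuousOnInterval (fun x => g (f x)) a b := by
  have hlim := Tendsto.const_mul (K : ℝ) hf
  rw [mul_zero] at hlim
  refine squeeze_zero' (.of_forall fun _ => Finset.sum_nonneg fun _ _ => dist_nonneg) ?_ hlim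
  rw [eventually_inf_principal]
  refine .of_forall fun E hE => ?_
  simp only [AbsolutelyContinuousOnInterval.disjWithin, mem_ofPred_eq] at hE
  rw [Finset.mul_sum]
  exact Finset.sum_le_sum fun i hi =>
    hg.dist_le_mul _ (hs (hE.1 i hi).1) _ (hs (hE.1 i hi).2)

theorem AbsolutelyContinuousOnInterval.exp {f : ℝ → ℝ} {a b : ℝ}
    (hf : AbsolutelyContinuousOnInterval f a b) :
    AbsolutelyContinuousOnInterval (fun x => Real.exp (f x)) a b := by
  obtain ⟨C, hC⟩ := hf.exists_bound
  have hlip : LipschitzOnWith (Real.exp C).toNNReal Real.exp (Iic C) := by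
    refine (convex_Iic C).lipschitzOnWith_of_nnnorm_deriv_le
      (fun x _ => Real.differentiableAt_exp) fun x hx => ?_
    rw [← NNReal.coe_le_coe, Real.coe_toNNReal _ (Real.exp_pos C).le, coe_nnnorm, Real.deriv_exp,
      Real.norm_of_nonneg (Real.exp_pos x).le]
    exact Real.exp_le_exp.2 hx
  exact hlip.comp_absolutelyContinuousOnInterval hf
    fun x hx => (le_abs_self _).trans (hC x hx)

/-- Integrated form of the linear differential inequality `ξ' + α ξ ≤ β` on `[a, b]`, when
the integrals of `α` over the terminal subintervals are bounded below by `-M`. -/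
theorem le_exp_mul_add_of_ae_deriv_add_mul_le {α β ξ ξ' : ℝ → ℝ} {a b M : ℝ} (hab : a ≤ b)
    (hα : IntervalIntegrable α volume a b) (hβ : IntervalIntegrable β volume a b)
    (hξ' : IntervalIntegrable ξ' volume a b)
    (hξ : ∀ x ∈ Icc a b, ξ x - ξ a = ∫ τ in a..x, ξ' τ)
    (hineq : ∀ᵐ t : ℝ, t ∈ Icc a b → ξ' t + α t * ξ t ≤ β t)
    (hM : ∀ x ∈ Icc a b, -M ≤ ∫ τ in x..b, α τ) :
    ξ b ≤ Real.exp (-∫ τ in a..b, α τ) * ξ a + Real.exp M * ∫ τ in a..b, max (β τ) 0 := by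
  let A : ℝ → ℝ := fun x => ∫ τ in b..x, α τ
  let η : ℝ → ℝ := fun x => ξ a + ∫ τ in a..x, ξ' τ
  have hη : ∀ x ∈ Icc a b, η x = ξ x := fun x hx => by
    simp only [η]; linarith [hξ x hx]
  have hE : AbsolutelyContinuousOnInterval (fun x => Real.exp (A x)) a b :=
    (hα.absolutelyContinuousOnInterval_intervalIntegral right_mem_uIcc).exp
  have hηac : AbsolutelyContinuousOnInterval η a b :=
    ((LipschitzWith.const (ξ a)).lipschitzOnWith.absolutelyContinuousOnInterval).fun_add
      (hξ'.absolutelyContinuousOnInterval_intervalIntegral left_mem_uIcc)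
  have hprod := hE.fun_mul hηac
  have hβpos : IntervalIntegrable (fun τ => max (β τ) 0) volume a b :=
    ⟨hβ.1.pos_part, hβ.2.pos_part⟩
  have hmono : ∫ x in a..b, deriv (fun x => Real.exp (A x) * η x) x
      ≤ ∫ x in a..b, Real.exp M * max (β x) 0 := by
    refine intervalIntegral.integral_mono_ae_restrict hab hprod.intervalIntegrable_deriv
      (hβpos.const_mul _) ?_
    rw [EventuallyLE, ae_restrict_iff' measurableSet_Icc]
    filter_upwards [hα.ae_hasDerivAt_integral, hξ'.ae_hasDerivAt_integral, hineq]
      with x hAx hξx hx hxmem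
    have hxu : x ∈ uIcc a b := by rwa [uIcc_of_le hab]
    have hd := ((hAx hxu b right_mem_uIcc).exp).mul
      ((hξx hxu a left_mem_uIcc).const_add (ξ a))
    have hd' : deriv (fun x => Real.exp (A x) * η x) x
        = Real.exp (A x) * (ξ' x + α x * ξ x) := by
      refine hd.deriv.trans ?_
      have := hη x hxmem
      simp only [η] at this
      rw [this]
      ring
    rw [hd']
    have hAM : A x ≤ M := by
      have := hM x hxmem
      simp only [A]
      rw [intervalIntegral.integral_symm]
      linarith
    calc Real.exp (A x) * (ξ' x + α x * ξ x)
        ≤ Real.exp (A x) * max (β x) 0 := by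
          gcongr
          exact (hx hxmem).trans (le_max_left _ _)
      _ ≤ Real.exp M * max (β x) 0 := by gcongr
  rw [hprod.integral_deriv_eq_sub, intervalIntegral.integral_const_mul,
    hη b (right_mem_Icc.2 hab), hη a (left_mem_Icc.2 hab)] at hmono
  have hAb : A b = 0 := intervalIntegral.integral_same
  have hAa : A a = -∫ τ in a..b, α τ := intervalIntegral.integral_symm _ _
  rw [hAb, hAa, Real.exp_zero, one_mul] at hmono
  linarith

/-- A nonnegative function which is locally bounded above and satisfies a contractive recursion
`u (s + T) ≤ q u s + ε s` with vanishing error `ε` tends to zero. -/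
theorem tendsto_zero_of_add_le_mul_add {u ε : ℝ → ℝ} {T q t₀ : ℝ} (hT : 0 < T) (hq₀ : 0 ≤ q)
    (hq : q < 1) (hu : ∀ t, t₀ ≤ t → 0 ≤ u t)
    (hbdd : ∀ t, t₀ ≤ t → BddAbove (u '' Icc t (t + T)))
    (hstep : ∀ t, t₀ ≤ t → u (t + T) ≤ q * u t + ε t) (hε : Tendsto ε atTop (𝓝 0)) :
    Tendsto u atTop (𝓝 0) := by
  rw [tendsto_order]
  refine ⟨fun r hr => ?_, fun r hr => ?_⟩
  · filter_upwards [eventually_ge_atTop t₀] with t ht using hr.trans_le (hu t ht)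
  have hε' : ∀ᶠ t in atTop, ε t < (1 - q) * (r / 2) :=
    (tendsto_order.1 hε).2 _ (by nlinarith)
  obtain ⟨t₁, ht₁⟩ := eventually_atTop.1 (hε'.and (eventually_ge_atTop t₀))
  have ht₀₁ : t₀ ≤ t₁ := (ht₁ t₁ le_rfl).2
  obtain ⟨B, hB⟩ := hbdd t₁ ht₀₁
  have hiter : ∀ n : ℕ, ∀ s ∈ Icc t₁ (t₁ + T), u (s + n * T) ≤ r / 2 + q ^ n * B := by
    intro n s hs
    induction n with
    | zero =>
      have := hB (mem_image_of_mem u hs)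
      simp only [Nat.cast_zero, zero_mul, add_zero, pow_zero, one_mul]
      linarith
    | succ n ih =>
      have hn : t₁ ≤ s + n * T := by
        have : 0 ≤ (n : ℝ) * T := by positivity
        linarith [hs.1]
      have h := hstep _ (ht₀₁.trans hn)
      have h' := (ht₁ _ hn).1
      have h'' := mul_le_mul_of_nonneg_left ih hq₀
      have heq : s + ((n + 1 : ℕ) : ℝ) * T = s + n * T + T := by push_cast; ring
      rw [heq, pow_succ]
      linarith
  have hn : Tendsto (fun t : ℝ => ⌊(t - t₁) / T⌋₊) atTop atTop :=
    tendsto_nat_floor_atTop.comp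
      ((tendsto_atTop_add_const_right _ (-t₁) tendsto_id).atTop_div_const hT)
  have hpow : Tendsto (fun t : ℝ => q ^ ⌊(t - t₁) / T⌋₊ * B) atTop (𝓝 0) := by
    simpa using ((tendsto_pow_atTop_nhds_zero_of_lt_one hq₀ hq).comp hn).mul_const B
  filter_upwards [(tendsto_order.1 hpow).2 (r / 2) (by linarith), eventually_ge_atTop t₁]
    with t ht htt₁
  have hle : (⌊(t - t₁) / T⌋₊ : ℝ) * T ≤ t - t₁ :=
    (le_div_iff₀ hT).1 (Nat.floor_le (div_nonneg (by linarith) hT.le))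
  have hlt : t - t₁ < (⌊(t - t₁) / T⌋₊ + 1) * T :=
    (div_lt_iff₀ hT).1 (Nat.lt_floor_add_one _)
  have h := hiter ⌊(t - t₁) / T⌋₊ (t - ⌊(t - t₁) / T⌋₊ * T) ⟨by linarith, by linarith⟩
  rw [sub_add_cancel] at h
  linarith

theorem MeasureTheory.LocallyIntegrableOn.intervalIntegrable_of_pos {f : ℝ → ℝ} {a b : ℝ}
    (hf : LocallyIntegrableOn f (Ioi 0) volume) (ha : 0 < a) (hb : 0 < b) :
    IntervalIntegrable f volume a b :=
  (intervalIntegrable_iff' (by simp)).2 <|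
    hf.integrableOn_compact_subset (fun _ hx => (lt_min ha hb).trans_le hx.1) isCompact_uIcc

/-- A real `liminf` that is positive (hence not a default value) gives a positive eventual
lower bound. -/
theorem exists_pos_eventually_le_of_liminf_pos {ι : Type*} {l : Filter ι} {f : ι → ℝ}
    (h : 0 < liminf f l) : ∃ c, 0 < c ∧ ∀ᶠ t in l, c ≤ f t := by
  rw [liminf_eq] at h
  have hne : {a | ∀ᶠ n in l, a ≤ f n}.Nonempty := by
    by_contra hempty
    rw [not_nonempty_iff_eq_empty.1 hempty, Real.sSup_empty] at h
    exact h.false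
  obtain ⟨c, hc, hc₀⟩ := exists_lt_of_lt_csSup hne h
  exact ⟨c, hc₀, hc⟩

theorem neg_integral_max_neg_le_integral {α : ℝ → ℝ} {a b x : ℝ}
    (hα : IntervalIntegrable α volume a b) (hx : x ∈ Icc a b) :
    -∫ τ in a..b, max (-α τ) 0 ≤ ∫ τ in x..b, α τ := by
  have hneg : IntervalIntegrable (fun τ => max (-α τ) 0) volume a b :=
    ⟨hα.1.neg_part, hα.2.neg_part⟩
  have hab : a ≤ b := hx.1.trans hx.2
  have hsub : uIcc x b ⊆ uIcc a b := by
    rw [uIcc_of_le hx.2, uIcc_of_le hab]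
    exact Icc_subset_Icc_left hx.1
  have h₁ : ∫ τ in x..b, max (-α τ) 0 ≤ ∫ τ in a..b, max (-α τ) 0 :=
    intervalIntegral.integral_mono_interval hx.1 hx.2 le_rfl
      (.of_forall fun _ => le_max_right _ _) hneg
  have h₂ : ∫ τ in x..b, -max (-α τ) 0 ≤ ∫ τ in x..b, α τ :=
    intervalIntegral.integral_mono_on hx.2 (hneg.mono_set hsub).neg (hα.mono_set hsub)
      fun τ _ => by linarith [le_max_left (-α τ) 0]
  rw [intervalIntegral.integral_neg] at h₂
  linarith

/-- A generalized Gronwall lemma (Lemma 2.2 in Ilyin–Titi).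
Local absolute continuity of `ξ` on `(0,∞)` is encoded via the fundamental theorem
of calculus: there is a locally integrable function `ξ'` (the a.e. derivative of `ξ`)
such that `ξ b - ξ a = ∫_a^b ξ'` for all `0 < a ≤ b`. -/
theorem generalized_gronwall_lemma
    (T : ℝ) (hT : 0 < T)
    (α β : ℝ → ℝ)
    (hα : LocallyIntegrableOn α (Set.Ioi 0) volume)
    (hβ : LocallyIntegrableOn β (Set.Ioi 0) volume)
    (hliminf : ∃ γ : ℝ, 0 < γ ∧
      liminf (fun t => (1 / T) * ∫ τ in t..(t + T), α τ) atTop = γ)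
    (hlimsup : ∃ Γ : ℝ,
      IsBoundedUnder (· ≤ ·) atTop
        (fun t => (1 / T) * ∫ τ in t..(t + T), max (-α τ) 0) ∧
      limsup (fun t => (1 / T) * ∫ τ in t..(t + T), max (-α τ) 0) atTop = Γ)
    (hβplus : Tendsto (fun t => (1 / T) * ∫ τ in t..(t + T), max (β τ) 0)
      atTop (nhds 0))
    (ξ ξ' : ℝ → ℝ)
    (hξnonneg : ∀ t ∈ Set.Ioi (0 : ℝ), 0 ≤ ξ t)
    (hξ'loc : LocallyIntegrableOn ξ' (Set.Ioi 0) volume)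
    (hAC : ∀ a b : ℝ, 0 < a → a ≤ b → ξ b - ξ a = ∫ τ in a..b, ξ' τ)
    (hineq : ∀ᵐ t : ℝ ∂volume, t ∈ Set.Ioi (0 : ℝ) → ξ' t + α t * ξ t ≤ β t) :
    Tendsto ξ atTop (nhds 0) := by
  obtain ⟨γ, hγ, hγeq⟩ := hliminf
  obtain ⟨c, hc, hcα⟩ := exists_pos_eventually_le_of_liminf_pos (hγeq ▸ hγ)
  obtain ⟨-, ⟨M, hM⟩, -⟩ := hlimsup
  rw [eventually_map] at hM
  obtain ⟨t₀, ht₀⟩ := eventually_atTop.1 (hcα.and (hM.and (eventually_gt_atTop 0)))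
  have hpos : ∀ t, t₀ ≤ t → 0 < t := fun t ht => (ht₀ t ht).2.2
  have hε : Tendsto (fun t => Real.exp (M * T) * ∫ τ in t..(t + T), max (β τ) 0)
      atTop (nhds 0) := by
    have h := hβplus.const_mul (Real.exp (M * T) * T)
    rw [mul_zero] at h
    refine h.congr fun t => ?_
    field_simp
  refine tendsto_zero_of_add_le_mul_add (q := Real.exp (-(c * T))) (t₀ := t₀) hT
    (Real.exp_pos _).le (Real.exp_lt_one_iff.2 (neg_neg_of_pos (mul_pos hc hT)))
    (fun t ht => hξnonneg t (hpos t ht)) (fun t ht => ?_) (fun t ht => ?_) hε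
  · have htpos := hpos t ht
    have htT : t ≤ t + T := by linarith
    have hcont := ((hξ'loc.intervalIntegrable_of_pos htpos (htpos.trans_le htT)
      ).absolutelyContinuousOnInterval_intervalIntegral left_mem_uIcc).continuousOn
    rw [uIcc_of_le htT] at hcont
    refine (isCompact_Icc.image_of_continuousOn ((hcont.const_add (ξ t)).congr
      fun x hx => ?_)).bddAbove
    linarith [hAC t x htpos hx.1]
  · have htpos := hpos t ht
    have htT : t ≤ t + T := by linarith
    have hTpos := htpos.trans_le htT
    obtain ⟨hct, hMt, -⟩ := ht₀ t ht
    have hct' : c * T ≤ ∫ τ in t..(t + T), α τ := by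
      rwa [one_div_mul_eq_div, le_div_iff₀ hT] at hct
    have hMt' : ∫ τ in t..(t + T), max (-α τ) 0 ≤ M * T := by
      rwa [one_div_mul_eq_div, div_le_iff₀ hT] at hMt
    have hαt := hα.intervalIntegrable_of_pos htpos hTpos
    have h := le_exp_mul_add_of_ae_deriv_add_mul_le (M := M * T) htT hαt
      (hβ.intervalIntegrable_of_pos htpos hTpos) (hξ'loc.intervalIntegrable_of_pos htpos hTpos)
      (fun x hx => hAC t x htpos hx.1)
      (hineq.mono fun x hx hxmem => hx (htpos.trans_le hxmem.1))
      fun x hx => (neg_le_neg hMt').trans (neg_integral_max_neg_le_integral hαt hx)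
    have hq := mul_le_mul_of_nonneg_right (Real.exp_le_exp.2 (neg_le_neg hct'))
      (hξnonneg t htpos)
    linarith
end

section
/- Let φ : ℝ² → ℝ be a smooth function, 2π-periodic in each variable, with mean value zero over T² = [0,2π]². Then ‖φ‖_∞² ≤ (1/π) · ‖φ‖ · ‖Δφ‖, that is, the sharp constant c_AT in the Agmon inequality ‖φ‖_∞ ≤ c_AT ‖φ‖^{1/2} ‖Δφ‖^{1/2} on the square torus satisfies c_AT² < 1/π. -/
open MeasureTheory Real

/-- First partial derivative of a function on `ℝ²`. -/
noncomputable def pd1 (f : ℝ × ℝ → ℝ) (p : ℝ × ℝ) : ℝ :=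
  deriv (fun s => f (s, p.2)) p.1

/-- Second partial derivative of a function on `ℝ²`. -/
noncomputable def pd2 (f : ℝ × ℝ → ℝ) (p : ℝ × ℝ) : ℝ :=
  deriv (fun s => f (p.1, s)) p.2

/-- The Laplacian `Δf = ∂₁²f + ∂₂²f`. -/
noncomputable def lap (f : ℝ × ℝ → ℝ) (p : ℝ × ℝ) : ℝ :=
  pd1 (pd1 f) p + pd2 (pd2 f) p

/-- The square torus `T² = [0,2π]²` (a fundamental cell). -/
noncomputable def cell2 : Set (ℝ × ℝ) :=
  Set.Icc (0 : ℝ) (2 * π) ×ˢ Set.Icc (0 : ℝ) (2 * π)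

lemma sum_range_div_sq_add_sq_le {l : ℝ} (hl : 0 < l) (N : ℕ) :
    ∑ j ∈ Finset.range N, l / (l ^ 2 + ((j : ℝ) + 1) ^ 2) ≤ arctan (N / l) := by
  induction N with
  | zero => simp
  | succ N ih =>
    rw [Finset.sum_range_succ]
    have hlt : (N : ℝ) / l < ((N + 1 : ℕ) : ℝ) / l := by
      gcongr; simp
    obtain ⟨c, hc, hd⟩ := exists_deriv_eq_slope arctan hlt continuous_arctan.continuousOn
      differentiable_arctan.differentiableOn
    rw [Real.deriv_arctan, eq_div_iff (by linarith)] at hd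
    have hc0 : 0 < c := lt_of_le_of_lt (by positivity) hc.1
    have hcl : c * l ≤ N + 1 := by
      have := hc.2.le
      rw [le_div_iff₀ hl] at this
      exact_mod_cast this
    have h1 : ((N + 1 : ℕ) : ℝ) / l - N / l = 1 / l := by push_cast; ring
    rw [h1] at hd
    have : l / (l ^ 2 + ((N : ℝ) + 1) ^ 2) ≤ 1 / (1 + c ^ 2) * (1 / l) := by
      rw [div_mul_div_comm, div_le_div_iff₀ (by positivity) (by positivity)]
      nlinarith [mul_pos hc0 hl]
    linarith

lemma Nat.pair_add_one_le (a b : ℕ) : Nat.pair a b + 1 ≤ (a + 1) ^ 2 + b ^ 2 := by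
  unfold Nat.pair
  split_ifs <;> nlinarith

lemma sum_quadrant_le {ι : Type*} {l : ℝ} (hl : 0 < l) (s : Finset ι) (a b : ι → ℕ)
    (hinj : Set.InjOn (fun i => (a i, b i)) s) :
    ∑ i ∈ s, l / (l ^ 2 + (((a i : ℝ) + 1) ^ 2 + (b i : ℝ) ^ 2) ^ 2) ≤ π / 2 := by
  classical
  have hinj' : Set.InjOn (fun i => Nat.pair (a i) (b i)) s := fun i hi j hj hij =>
    hinj hi hj (by simpa [Nat.pair_eq_pair] using hij)
  obtain ⟨N, hN⟩ := (s.image fun i => Nat.pair (a i) (b i)).exists_nat_subset_range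
  calc ∑ i ∈ s, l / (l ^ 2 + (((a i : ℝ) + 1) ^ 2 + (b i : ℝ) ^ 2) ^ 2)
      ≤ ∑ i ∈ s, l / (l ^ 2 + ((Nat.pair (a i) (b i) : ℝ) + 1) ^ 2) := by
        refine Finset.sum_le_sum fun i _ => ?_
        have h : (Nat.pair (a i) (b i) : ℝ) + 1 ≤ ((a i : ℝ) + 1) ^ 2 + (b i : ℝ) ^ 2 := by
          exact_mod_cast Nat.pair_add_one_le (a i) (b i)
        exact div_le_div_of_nonneg_left hl.le (by positivity) (by gcongr)
    _ = ∑ j ∈ s.image fun i => Nat.pair (a i) (b i), l / (l ^ 2 + ((j : ℝ) + 1) ^ 2) :=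
        (Finset.sum_image (f := fun j : ℕ => l / (l ^ 2 + ((j : ℝ) + 1) ^ 2)) hinj').symm
    _ ≤ ∑ j ∈ Finset.range N, l / (l ^ 2 + ((j : ℝ) + 1) ^ 2) :=
        Finset.sum_le_sum_of_subset_of_nonneg hN fun _ _ _ => by positivity
    _ ≤ arctan (N / l) := sum_range_div_sq_add_sq_le hl N
    _ ≤ π / 2 := (arctan_lt_pi_div_two _).le

/-- The squared Euclidean length of an integer frequency. -/
def freqSq (k : Fin 2 → ℤ) : ℝ := (k 0 : ℝ) ^ 2 + (k 1 : ℝ) ^ 2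

lemma sum_lattice_le {l : ℝ} (hl : 0 < l) (s : Finset (Fin 2 → ℤ)) (hs : 0 ∉ s) :
    ∑ k ∈ s, l / (l ^ 2 + freqSq k ^ 2) ≤ 2 * π := by
  classical
  have key : ∀ (P : (Fin 2 → ℤ) → Prop) (A B : (Fin 2 → ℤ) → ℤ),
      (∀ k, P k → 0 < A k ∧ 0 ≤ B k ∧ freqSq k = (A k : ℝ) ^ 2 + (B k : ℝ) ^ 2) →
      (∀ k k', A k = A k' → B k = B k' → k = k') →
      ∑ k ∈ s with P k, l / (l ^ 2 + freqSq k ^ 2) ≤ π / 2 := by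
    intro P A B h1 h2
    refine le_of_eq_of_le (Finset.sum_congr rfl fun k hk => ?_)
      (sum_quadrant_le hl (s.filter P) (fun k => (A k - 1).toNat) (fun k => (B k).toNat) ?_)
    · obtain ⟨hA, hB, hq⟩ := h1 k (Finset.mem_filter.1 hk).2
      have e1 : (((A k - 1).toNat : ℕ) : ℝ) + 1 = A k := by
        have : (((A k - 1).toNat : ℕ) : ℤ) + 1 = A k := by omega
        exact_mod_cast this
      have e2 : (((B k).toNat : ℕ) : ℝ) = B k := by
        have : (((B k).toNat : ℕ) : ℤ) = B k := by omega
        exact_mod_cast this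
      rw [e1, e2, hq]
    · intro k hk k' hk' h
      obtain ⟨hA, hB, -⟩ := h1 k (Finset.mem_filter.1 hk).2
      obtain ⟨hA', hB', -⟩ := h1 k' (Finset.mem_filter.1 hk').2
      simp only [Prod.mk.injEq] at h
      exact h2 k k' (by omega) (by omega)
  have ext2 : ∀ k k' : Fin 2 → ℤ, k 0 = k' 0 → k 1 = k' 1 → k = k' := fun k k' h h' => by
    ext i; fin_cases i <;> assumption
  have h1 := key (fun k => 0 < k 0 ∧ 0 ≤ k 1) (fun k => k 0) (fun k => k 1)
    (fun k h => ⟨h.1, h.2, rfl⟩) (fun k k' h h' => ext2 k k' h h')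
  have h2 := key (fun k => 0 < k 1 ∧ 0 ≤ - k 0) (fun k => k 1) (fun k => - k 0)
    (fun k h => ⟨h.1, h.2, by simp [freqSq, add_comm]⟩)
    (fun k k' h h' => ext2 k k' (by omega) (by omega))
  have h3 := key (fun k => 0 < - k 0 ∧ 0 ≤ - k 1) (fun k => - k 0) (fun k => - k 1)
    (fun k h => ⟨h.1, h.2, by simp [freqSq]⟩)
    (fun k k' h h' => ext2 k k' (by omega) (by omega))
  have h4 := key (fun k => 0 < - k 1 ∧ 0 ≤ k 0) (fun k => - k 1) (fun k => k 0)
    (fun k h => ⟨h.1, h.2, by simp [freqSq, add_comm]⟩)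
    (fun k k' h h' => ext2 k k' (by omega) (by omega))
  rw [Finset.sum_filter] at h1 h2 h3 h4
  have : ∑ k ∈ s, l / (l ^ 2 + freqSq k ^ 2) ≤ π / 2 + π / 2 + π / 2 + π / 2 := by
    refine le_trans ?_ (add_le_add (add_le_add (add_le_add h1 h2) h3) h4)
    rw [← Finset.sum_add_distrib, ← Finset.sum_add_distrib, ← Finset.sum_add_distrib]
    refine Finset.sum_le_sum fun k hk => ?_
    have hk0 : ¬ (k 0 = 0 ∧ k 1 = 0) := fun h => hs (ext2 k 0 h.1 h.2 ▸ hk)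
    have hp : 0 ≤ l / (l ^ 2 + freqSq k ^ 2) := by positivity
    split_ifs <;> first | linarith | (exfalso; omega)
  linarith

lemma one_le_freqSq {k : Fin 2 → ℤ} (hk : k ≠ 0) : 1 ≤ freqSq k := by
  have : 0 < k 0 ^ 2 + k 1 ^ 2 := by
    by_contra! h
    apply hk
    ext i
    fin_cases i <;> simp <;> nlinarith [sq_nonneg (k 0), sq_nonneg (k 1)]
  unfold freqSq
  exact_mod_cast this

/-- Agmon's inequality for sequences on `ℤ²`. -/
lemma sum_norm_sq_le {c : (Fin 2 → ℤ) → ℂ} (h0 : c 0 = 0) {A B : ℝ}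
    (hA : HasSum (fun k => ‖c k‖ ^ 2) (A ^ 2))
    (hB : HasSum (fun k => (freqSq k * ‖c k‖) ^ 2) (B ^ 2)) (hA0 : 0 ≤ A) (hB0 : 0 ≤ B)
    (s : Finset (Fin 2 → ℤ)) :
    (∑ k ∈ s, ‖c k‖) ^ 2 ≤ 4 * π * A * B := by
  classical
  have hAs : ∀ s : Finset (Fin 2 → ℤ), ∑ k ∈ s, ‖c k‖ ^ 2 ≤ A ^ 2 := fun s =>
    sum_le_hasSum s (fun _ _ => by positivity) hA
  have hBs : ∀ s : Finset (Fin 2 → ℤ), ∑ k ∈ s, (freqSq k * ‖c k‖) ^ 2 ≤ B ^ 2 := fun s =>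
    sum_le_hasSum s (fun _ _ => by positivity) hB
  have hAB : A ≤ B := by
    refine (sq_le_sq₀ hA0 hB0).1 (hasSum_le (fun k => ?_) hA hB)
    by_cases hk : k = 0
    · simp [hk, h0]
    · have := one_le_freqSq hk
      have := norm_nonneg (c k)
      gcongr
      nlinarith
  rcases hA0.eq_or_lt with h | hApos
  · have : ∀ k, ‖c k‖ = 0 := fun k => by
      have := hAs {k}
      rw [← h] at this
      simp only [Finset.sum_singleton] at this
      nlinarith [norm_nonneg (c k)]
    simp [this, ← h]
  have hBpos : 0 < B := hApos.trans_le hAB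
  set l := B / A with hl
  have hlpos : 0 < l := by positivity
  have herase : ∑ k ∈ s, ‖c k‖ = ∑ k ∈ s.erase 0, ‖c k‖ := by
    rw [Finset.sum_erase]; simp [h0]
  rw [herase]
  set t := s.erase 0
  have hcs := Finset.sum_sq_le_sum_mul_sum_of_sq_le_mul t
    (r := fun k => ‖c k‖) (f := fun k => l / (l ^ 2 + freqSq k ^ 2))
    (g := fun k => l * ‖c k‖ ^ 2 + l⁻¹ * (freqSq k * ‖c k‖) ^ 2)
    (fun k _ => by positivity) (fun k _ => by positivity) (fun k _ => le_of_eq (by field_simp))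
  refine hcs.trans ?_
  have h1 := sum_lattice_le hlpos t (by simp [t])
  have h2 : ∑ k ∈ t, (l * ‖c k‖ ^ 2 + l⁻¹ * (freqSq k * ‖c k‖) ^ 2) ≤ 2 * A * B := by
    rw [Finset.sum_add_distrib, ← Finset.mul_sum, ← Finset.mul_sum]
    have e : 2 * A * B = l * A ^ 2 + l⁻¹ * B ^ 2 := by rw [hl]; field_simp; ring
    rw [e]
    gcongr
    · exact hAs t
    · exact hBs t
  calc _ ≤ (2 * π) * (2 * A * B) := by
        refine mul_le_mul h1 h2 (Finset.sum_nonneg fun k _ => by positivity) (by positivity)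
    _ = _ := by ring

section FourierSeries

variable {E : Type*} [NormedAddCommGroup E] [NormedSpace ℝ E]

lemma setIntegral_Ioc_prod_eq {G : ℝ × ℝ → E} (hG : Continuous G) {T : ℝ} (hT : 0 ≤ T) :
    ∫ p in Set.Ioc 0 T ×ˢ Set.Ioc 0 T, G p = ∫ x in 0..T, ∫ y in 0..T, G (x, y) := by
  have hint : IntegrableOn G (Set.Ioc 0 T ×ˢ Set.Ioc 0 T) (volume.prod volume) :=
    (hG.continuousOn.integrableOn_compact (isCompact_Icc.prod isCompact_Icc)).mono_set
      (Set.prod_mono Set.Ioc_subset_Icc_self Set.Ioc_subset_Icc_self)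
  rw [Measure.volume_eq_prod, setIntegral_prod _ hint]
  simp_rw [intervalIntegral.integral_of_le hT]

lemma setIntegral_cell2_eq {G : ℝ × ℝ → E} (hG : Continuous G) :
    ∫ p in cell2, G p = ∫ x in 0..2 * π, ∫ y in 0..2 * π, G (x, y) := by
  have hint : IntegrableOn G cell2 (volume.prod volume) :=
    hG.continuousOn.integrableOn_compact (isCompact_Icc.prod isCompact_Icc)
  rw [cell2, Measure.volume_eq_prod, setIntegral_prod _ hint]
  simp_rw [intervalIntegral.integral_of_le two_pi_pos.le, integral_Icc_eq_integral_Ioc]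

lemma setIntegral_unitBox_eq {G : ℝ × ℝ → E} (hG : Continuous G) :
    ∫ x in {x : Fin 2 → ℝ | ∀ i, x i ∈ Set.Ioc ((0 : Fin 2 → ℝ) i) ((0 : Fin 2 → ℝ) i + 1)},
        G (2 * π * x 0, 2 * π * x 1) =
      (4 * π ^ 2)⁻¹ • ∫ x in 0..2 * π, ∫ y in 0..2 * π, G (x, y) := by
  have hset : {x : Fin 2 → ℝ | ∀ i, x i ∈ Set.Ioc ((0 : Fin 2 → ℝ) i) ((0 : Fin 2 → ℝ) i + 1)} =
      MeasurableEquiv.finTwoArrow ⁻¹' (Set.Ioc (0 : ℝ) 1 ×ˢ Set.Ioc (0 : ℝ) 1) := by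
    ext x
    simp [MeasurableEquiv.finTwoArrow, Fin.forall_fin_two]
  rw [hset]
  have h := (volume_preserving_finTwoArrow ℝ).setIntegral_preimage_emb
    (MeasurableEquiv.measurableEmbedding _) (fun p => G (2 * π * p.1, 2 * π * p.2))
    (Set.Ioc (0 : ℝ) 1 ×ˢ Set.Ioc (0 : ℝ) 1)
  refine h.trans ?_
  rw [setIntegral_Ioc_prod_eq (by fun_prop) zero_le_one]
  have hpi : (2 * π) ≠ 0 := two_pi_pos.ne'
  have inner : ∀ a : ℝ, ∫ y in (0 : ℝ)..1, G (a, 2 * π * y) =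
      (2 * π)⁻¹ • ∫ y in 0..2 * π, G (a, y) := fun a => by
    simpa using intervalIntegral.integral_comp_mul_left (a := 0) (b := 1)
      (fun y => G (a, y)) hpi
  simp_rw [inner]
  rw [intervalIntegral.integral_smul, intervalIntegral.integral_comp_mul_left
    (fun x => ∫ y in 0..2 * π, G (x, y)) hpi, smul_smul]
  simp only [mul_zero, mul_one]
  congr 1
  field_simp
  norm_num

/-- A continuous doubly `2π`-periodic function descends to the unit torus after rescaling. -/
lemma exists_lift_unitAddTorus {f : ℝ × ℝ → ℝ} (hf : Continuous f)
    (h1 : ∀ p : ℝ × ℝ, f (p.1 + 2 * π, p.2) = f p)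
    (h2 : ∀ p : ℝ × ℝ, f (p.1, p.2 + 2 * π) = f p) :
    ∃ F : C(UnitAddTorus (Fin 2), ℂ), ∀ x : Fin 2 → ℝ,
      F (fun i => (x i : UnitAddCircle)) = (f (2 * π * x 0, 2 * π * x 1) : ℂ) := by
  have hq : IsOpenQuotientMap (Pi.map fun (_ : Fin 2) (x : ℝ) => (x : UnitAddCircle)) :=
    IsOpenQuotientMap.piMap fun _ => QuotientAddGroup.isOpenQuotientMap_mk
  let F : UnitAddTorus (Fin 2) → ℂ := fun t =>
    f (2 * π * (Function.surjInv hq.surjective t) 0, 2 * π * (Function.surjInv hq.surjective t) 1)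
  have per : ∀ (x y : ℝ) (m n : ℤ), f (2 * π * (x + m), 2 * π * (y + n)) =
      f (2 * π * x, 2 * π * y) := by
    intro x y m n
    have p1 : Function.Periodic (fun s => f (s, 2 * π * (y + n))) (2 * π) := fun s => h1 (s, _)
    have p2 : Function.Periodic (fun s => f (2 * π * x, s)) (2 * π) := fun s => h2 (_, s)
    have e1 := p1.int_mul m (2 * π * x)
    have e2 := p2.int_mul n (2 * π * y)
    rw [← e2, ← show 2 * π * (y + n) = 2 * π * y + n * (2 * π) by ring, ← e1]
    ring_nf
  have hF : ∀ x : Fin 2 → ℝ,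
      F (fun i => (x i : UnitAddCircle)) = (f (2 * π * x 0, 2 * π * x 1) : ℂ) := by
    intro x
    have hs := Function.surjInv_eq hq.surjective (fun i => (x i : UnitAddCircle))
    have : ∀ i, ∃ n : ℤ, Function.surjInv hq.surjective (fun i => (x i : UnitAddCircle)) i =
        x i + n := fun i => by
      have hi := congrFun hs i
      simp only [Pi.map_apply] at hi
      rw [← sub_eq_zero, ← AddCircle.coe_sub, AddCircle.coe_eq_zero_iff] at hi
      obtain ⟨n, hn⟩ := hi
      exact ⟨n, by simp only [zsmul_eq_mul, mul_one] at hn; linarith⟩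
    obtain ⟨m, hm⟩ := this 0
    obtain ⟨n, hn⟩ := this 1
    simp only [F, hm, hn, per]
  refine ⟨⟨F, ?_⟩, hF⟩
  rw [← hq.continuous_comp_iff]
  have : F ∘ (Pi.map fun (_ : Fin 2) (x : ℝ) => (x : UnitAddCircle)) =
      fun x : Fin 2 → ℝ => (f (2 * π * x 0, 2 * π * x 1) : ℂ) := funext hF
  rw [this]
  fun_prop

/-- The Fourier coefficients of a doubly `2π`-periodic function. -/
noncomputable def doubleFourierCoeff (f : ℝ × ℝ → ℝ) (k : Fin 2 → ℤ) : ℂ :=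
  (4 * π ^ 2 : ℝ)⁻¹ • ∫ x in 0..2 * π, ∫ y in 0..2 * π,
    Complex.exp (-(Complex.I * k 0 * x)) * Complex.exp (-(Complex.I * k 1 * y)) * (f (x, y) : ℂ)

lemma mFourierCoeff_lift_eq {f : ℝ × ℝ → ℝ} (hf : Continuous f) {F : C(UnitAddTorus (Fin 2), ℂ)}
    (hF : ∀ x : Fin 2 → ℝ,
      F (fun i => (x i : UnitAddCircle)) = (f (2 * π * x 0, 2 * π * x 1) : ℂ))
    (k : Fin 2 → ℤ) : UnitAddTorus.mFourierCoeff F k = doubleFourierCoeff f k := by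
  rw [UnitAddTorus.mFourierCoeff_eq_integral _ _ 0, doubleFourierCoeff]
  have h := setIntegral_unitBox_eq (G := fun p => Complex.exp (-(Complex.I * k 0 * p.1)) *
    Complex.exp (-(Complex.I * k 1 * p.2)) * (f p : ℂ)) (by fun_prop)
  rw [← h]
  congr 1
  ext x
  simp only [hF, UnitAddTorus.mFourier, ContinuousMap.coe_mk, Fin.prod_univ_two, Pi.neg_apply,
    fourier_coe_apply, smul_eq_mul]
  congr 3
  all_goals push_cast; ring_nf

lemma hasSum_sq_doubleFourierCoeff {f : ℝ × ℝ → ℝ} (hf : Continuous f)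
    (h1 : ∀ p : ℝ × ℝ, f (p.1 + 2 * π, p.2) = f p)
    (h2 : ∀ p : ℝ × ℝ, f (p.1, p.2 + 2 * π) = f p) :
    HasSum (fun k => ‖doubleFourierCoeff f k‖ ^ 2)
      ((4 * π ^ 2)⁻¹ * ∫ p in cell2, f p ^ 2) := by
  obtain ⟨F, hF⟩ := exists_lift_unitAddTorus hf h1 h2
  let μ : Measure (UnitAddTorus (Fin 2)) := Measure.pi fun _ => AddCircle.haarAddCircle
  have h : HasSum (fun k => ‖UnitAddTorus.mFourierCoeff (ContinuousMap.toLp 2 μ ℂ F) k‖ ^ 2)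
      (∫ t, ‖ContinuousMap.toLp 2 μ ℂ F t‖ ^ 2 ∂μ) :=
    UnitAddTorus.hasSum_sq_mFourierCoeff (ContinuousMap.toLp 2 μ ℂ F)
  have hc : ∀ k, UnitAddTorus.mFourierCoeff (ContinuousMap.toLp 2 μ ℂ F) k =
      doubleFourierCoeff f k := fun k =>
    (UnitAddTorus.mFourierCoeff_toLp F k).trans (mFourierCoeff_lift_eq hf hF k)
  have hn : ∫ t, ‖ContinuousMap.toLp 2 μ ℂ F t‖ ^ 2 ∂μ = ∫ t, ‖F t‖ ^ 2 ∂μ := by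
    refine integral_congr_ae ?_
    filter_upwards [ContinuousMap.coeFn_toLp (p := 2) (𝕜 := ℂ) μ F] with t ht
    rw [ht]
  simp_rw [hc] at h
  rw [hn, show ∫ t, ‖F t‖ ^ 2 ∂μ = _ from
    UnitAddTorus.integral_preimage (fun t => ‖F t‖ ^ 2) 0] at h
  simp only [hF, Complex.norm_real, norm_eq_abs, sq_abs] at h
  rw [setIntegral_unitBox_eq (G := fun p => f p ^ 2) (by fun_prop),
    ← setIntegral_cell2_eq (G := fun p => f p ^ 2) (by fun_prop)] at h
  exact h

lemma abs_le_of_sum_doubleFourierCoeff_le {f : ℝ × ℝ → ℝ} (hf : Continuous f)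
    (h1 : ∀ p : ℝ × ℝ, f (p.1 + 2 * π, p.2) = f p)
    (h2 : ∀ p : ℝ × ℝ, f (p.1, p.2 + 2 * π) = f p) {C : ℝ}
    (hC : ∀ s : Finset (Fin 2 → ℤ), ∑ k ∈ s, ‖doubleFourierCoeff f k‖ ≤ C) (p : ℝ × ℝ) :
    |f p| ≤ C := by
  obtain ⟨F, hF⟩ := exists_lift_unitAddTorus hf h1 h2
  have hsum : Summable fun k => ‖doubleFourierCoeff f k‖ :=
    summable_of_sum_le (fun _ => norm_nonneg _) hC
  have hsum' : Summable (UnitAddTorus.mFourierCoeff F) := by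
    refine Summable.of_norm ?_
    simpa only [mFourierCoeff_lift_eq hf hF] using hsum
  have hs := UnitAddTorus.hasSum_mFourier_series_apply_of_summable hsum'
    (fun i => ((![p.1 / (2 * π), p.2 / (2 * π)] i : ℝ) : UnitAddCircle))
  rw [hF] at hs
  have hpi : (2 * π) ≠ 0 := two_pi_pos.ne'
  have e : (2 * π * ![p.1 / (2 * π), p.2 / (2 * π)] 0,
      2 * π * ![p.1 / (2 * π), p.2 / (2 * π)] 1) = p := by
    ext <;> simp <;> field_simp
  rw [e] at hs
  have := hs.norm_le_of_bounded hsum.hasSum (fun k => by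
    rw [norm_smul, mFourierCoeff_lift_eq hf hF]
    refine mul_le_of_le_one_right (norm_nonneg _) ?_
    exact ((UnitAddTorus.mFourier k).norm_coe_le_norm _).trans UnitAddTorus.mFourier_norm.le)
  rw [Complex.norm_real, norm_eq_abs] at this
  exact this.trans (hsum.tsum_le_of_sum_le hC)

end FourierSeries

section PartialDerivatives

variable {f : ℝ × ℝ → ℝ}

lemma hasDerivAt_pd1 (hf : ContDiff ℝ (⊤ : ℕ∞) f) (x y : ℝ) :
    HasDerivAt (fun s => f (s, y)) (pd1 f (x, y)) x := by
  have : Differentiable ℝ fun s => f (s, y) :=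
    (hf.differentiable (by simp)).comp (by fun_prop)
  exact (this x).hasDerivAt

lemma hasDerivAt_pd2 (hf : ContDiff ℝ (⊤ : ℕ∞) f) (x y : ℝ) :
    HasDerivAt (fun s => f (x, s)) (pd2 f (x, y)) y := by
  have : Differentiable ℝ fun s => f (x, s) :=
    (hf.differentiable (by simp)).comp (by fun_prop)
  exact (this y).hasDerivAt

lemma contDiff_pd1 (hf : ContDiff ℝ (⊤ : ℕ∞) f) : ContDiff ℝ (⊤ : ℕ∞) (pd1 f) := by
  have h : pd1 f = fun p => fderiv ℝ f p (1, 0) := by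
    ext p
    refine (hasDerivAt_pd1 hf p.1 p.2).unique ?_
    exact ((hf.differentiable (by simp)) p).hasFDerivAt.comp_hasDerivAt p.1
      ((hasDerivAt_id p.1).prodMk (hasDerivAt_const p.1 p.2))
  rw [h]
  exact (hf.fderiv_right (by simp)).clm_apply contDiff_const

lemma contDiff_pd2 (hf : ContDiff ℝ (⊤ : ℕ∞) f) : ContDiff ℝ (⊤ : ℕ∞) (pd2 f) := by
  have h : pd2 f = fun p => fderiv ℝ f p (0, 1) := by
    ext p
    refine (hasDerivAt_pd2 hf p.1 p.2).unique ?_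
    exact ((hf.differentiable (by simp)) p).hasFDerivAt.comp_hasDerivAt p.2
      ((hasDerivAt_const p.2 p.1).prodMk (hasDerivAt_id p.2))
  rw [h]
  exact (hf.fderiv_right (by simp)).clm_apply contDiff_const

lemma pd1_periodic_fst {c : ℝ} (h : ∀ p : ℝ × ℝ, f (p.1 + c, p.2) = f p) (p : ℝ × ℝ) :
    pd1 f (p.1 + c, p.2) = pd1 f p := by
  simp only [pd1]
  rw [← deriv_comp_add_const]
  congr 1
  ext s
  exact h (s, p.2)

lemma pd2_periodic_snd {c : ℝ} (h : ∀ p : ℝ × ℝ, f (p.1, p.2 + c) = f p) (p : ℝ × ℝ) :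
    pd2 f (p.1, p.2 + c) = pd2 f p := by
  simp only [pd2]
  rw [← deriv_comp_add_const]
  congr 1
  ext s
  exact h (p.1, s)

lemma pd1_periodic_snd {c : ℝ} (h : ∀ p : ℝ × ℝ, f (p.1, p.2 + c) = f p) (p : ℝ × ℝ) :
    pd1 f (p.1, p.2 + c) = pd1 f p := by
  simp only [pd1]
  congr 1
  ext s
  exact h (s, p.2)

lemma pd2_periodic_fst {c : ℝ} (h : ∀ p : ℝ × ℝ, f (p.1 + c, p.2) = f p) (p : ℝ × ℝ) :
    pd2 f (p.1 + c, p.2) = pd2 f p := by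
  simp only [pd2]
  congr 1
  ext s
  exact h (p.1, s)

lemma integral_exp_mul_deriv_periodic {u u' : ℝ → ℝ} (hu : ∀ x, HasDerivAt u (u' x) x)
    (hu' : Continuous u') (hper : u (2 * π) = u 0) (m : ℤ) :
    ∫ x in 0..2 * π, Complex.exp (-(Complex.I * m * x)) * (u' x : ℂ) =
      Complex.I * m * ∫ x in 0..2 * π, Complex.exp (-(Complex.I * m * x)) * (u x : ℂ) := by
  have hexp : ∀ x : ℝ, HasDerivAt (fun x : ℝ => Complex.exp (-(Complex.I * m * x)))
      (-(Complex.I * m) * Complex.exp (-(Complex.I * m * x))) x := fun x => by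
    have h := ((Complex.ofRealCLM.hasDerivAt (x := x)).const_mul (Complex.I * m)).neg.cexp
    simpa [mul_comm] using h
  have hend : Complex.exp (-(Complex.I * m * ((2 * π : ℝ) : ℂ))) = 1 := by
    rw [Complex.exp_eq_one_iff]
    exact ⟨-m, by push_cast; ring⟩
  rw [intervalIntegral.integral_mul_deriv_eq_deriv_mul (fun x _ => hexp x)
    (fun x _ => (hu x).ofReal_comp) (Continuous.intervalIntegrable (by fun_prop) _ _)
    (Continuous.intervalIntegrable (by fun_prop) _ _), hend, hper,
    ← intervalIntegral.integral_const_mul, ← sub_eq_zero]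
  simp only [Complex.ofReal_zero, mul_zero, neg_zero, Complex.exp_zero, sub_self, zero_sub, neg_mul,
    intervalIntegral.integral_neg, neg_neg, mul_assoc]

lemma doubleFourierCoeff_pd2 (hf : ContDiff ℝ (⊤ : ℕ∞) f)
    (h2 : ∀ p : ℝ × ℝ, f (p.1, p.2 + 2 * π) = f p) (k : Fin 2 → ℤ) :
    doubleFourierCoeff (pd2 f) k = Complex.I * k 1 * doubleFourierCoeff f k := by
  unfold doubleFourierCoeff
  rw [mul_smul_comm, ← intervalIntegral.integral_const_mul]
  congr 2
  ext x
  have h := integral_exp_mul_deriv_periodic (hasDerivAt_pd2 hf x)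
    ((contDiff_pd2 hf).continuous.comp (by fun_prop)) (by simpa using h2 (x, 0)) (k 1)
  simp_rw [mul_assoc (Complex.exp _), intervalIntegral.integral_const_mul]
  rw [h]
  ring

lemma doubleFourierCoeff_swap (hf : Continuous f) (k : Fin 2 → ℤ) :
    doubleFourierCoeff f k = (4 * π ^ 2 : ℝ)⁻¹ • ∫ y in 0..2 * π, ∫ x in 0..2 * π,
      Complex.exp (-(Complex.I * k 1 * y)) * (Complex.exp (-(Complex.I * k 0 * x)) *
        (f (x, y) : ℂ)) := by
  unfold doubleFourierCoeff
  rw [intervalIntegral_intervalIntegral_swap]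
  · congr 5
    ext y
    congr 1
    ext x
    ring
  · have hc : Continuous (Function.uncurry fun x y : ℝ => Complex.exp (-(Complex.I * k 0 * x)) *
        Complex.exp (-(Complex.I * k 1 * y)) * (f (x, y) : ℂ)) := by
      unfold Function.uncurry
      fun_prop
    exact (hc.continuousOn.integrableOn_compact
      (isCompact_uIcc.prod isCompact_uIcc)).mono_set
      (Set.prod_mono Set.uIoc_subset_uIcc Set.uIoc_subset_uIcc)

lemma doubleFourierCoeff_pd1 (hf : ContDiff ℝ (⊤ : ℕ∞) f)
    (h1 : ∀ p : ℝ × ℝ, f (p.1 + 2 * π, p.2) = f p) (k : Fin 2 → ℤ) :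
    doubleFourierCoeff (pd1 f) k = Complex.I * k 0 * doubleFourierCoeff f k := by
  rw [doubleFourierCoeff_swap (contDiff_pd1 hf).continuous, doubleFourierCoeff_swap hf.continuous,
    mul_smul_comm, ← intervalIntegral.integral_const_mul]
  congr 2
  ext y
  have h := integral_exp_mul_deriv_periodic (fun x => hasDerivAt_pd1 hf x y)
    ((contDiff_pd1 hf).continuous.comp (by fun_prop)) (by simpa using h1 (0, y)) (k 0)
  simp_rw [intervalIntegral.integral_const_mul]
  rw [h]
  ring

lemma doubleFourierCoeff_add {g : ℝ × ℝ → ℝ} (hf : Continuous f) (hg : Continuous g)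
    (k : Fin 2 → ℤ) : doubleFourierCoeff (fun p => f p + g p) k =
      doubleFourierCoeff f k + doubleFourierCoeff g k := by
  unfold doubleFourierCoeff
  rw [← smul_add, ← intervalIntegral.integral_add]
  · congr 2
    ext x
    rw [← intervalIntegral.integral_add]
    · congr 1
      ext y
      push_cast
      ring
    all_goals exact Continuous.intervalIntegrable (by fun_prop) _ _
  all_goals
    refine Continuous.intervalIntegrable ?_ _ _
    apply intervalIntegral.continuous_parametric_intervalIntegral_of_continuous'
    unfold Function.uncurry
    fun_prop

lemma doubleFourierCoeff_lap (hf : ContDiff ℝ (⊤ : ℕ∞) f)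
    (h1 : ∀ p : ℝ × ℝ, f (p.1 + 2 * π, p.2) = f p)
    (h2 : ∀ p : ℝ × ℝ, f (p.1, p.2 + 2 * π) = f p) (k : Fin 2 → ℤ) :
    doubleFourierCoeff (lap f) k = -(freqSq k : ℂ) * doubleFourierCoeff f k := by
  have h : lap f = fun p => pd1 (pd1 f) p + pd2 (pd2 f) p := rfl
  rw [h, doubleFourierCoeff_add (contDiff_pd1 (contDiff_pd1 hf)).continuous
    (contDiff_pd2 (contDiff_pd2 hf)).continuous,
    doubleFourierCoeff_pd1 (contDiff_pd1 hf) (pd1_periodic_fst h1),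
    doubleFourierCoeff_pd2 (contDiff_pd2 hf) (pd2_periodic_snd h2),
    doubleFourierCoeff_pd1 hf h1, doubleFourierCoeff_pd2 hf h2, freqSq]
  push_cast
  linear_combination ((k 0 : ℂ) ^ 2 + (k 1 : ℂ) ^ 2) * doubleFourierCoeff f k * Complex.I_sq

end PartialDerivatives

lemma doubleFourierCoeff_zero {f : ℝ × ℝ → ℝ} (hf : Continuous f)
    (hmean : ∫ p in cell2, f p = 0) : doubleFourierCoeff f 0 = 0 := by
  rw [setIntegral_cell2_eq hf] at hmean
  simp [doubleFourierCoeff, intervalIntegral.integral_ofReal, hmean]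

/-- Sharp Agmon inequality on the square torus:
`‖φ‖_∞² ≤ (1/π) ‖φ‖ ‖Δφ‖` for smooth `2π`-periodic mean-zero `φ`. -/
theorem agmon_square_torus
    (φ : ℝ × ℝ → ℝ)
    (hsmooth : ContDiff ℝ (⊤ : ℕ∞) φ)
    (hper1 : ∀ p : ℝ × ℝ, φ (p.1 + 2 * π, p.2) = φ p)
    (hper2 : ∀ p : ℝ × ℝ, φ (p.1, p.2 + 2 * π) = φ p)
    (hmean : (∫ p in cell2, φ p) = 0) :
    (⨆ p ∈ cell2, |φ p|) ^ 2 ≤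
      (1 / π) * Real.sqrt (∫ p in cell2, (φ p) ^ 2) *
        Real.sqrt (∫ p in cell2, (lap φ p) ^ 2) := by
  have hlap : ContDiff ℝ (⊤ : ℕ∞) (lap φ) :=
    (contDiff_pd1 (contDiff_pd1 hsmooth)).add (contDiff_pd2 (contDiff_pd2 hsmooth))
  have hlap1 : ∀ p : ℝ × ℝ, lap φ (p.1 + 2 * π, p.2) = lap φ p := fun p =>
    congrArg₂ (· + ·) (pd1_periodic_fst (pd1_periodic_fst hper1) p)
      (pd2_periodic_fst (pd2_periodic_fst hper1) p)
  have hlap2 : ∀ p : ℝ × ℝ, lap φ (p.1, p.2 + 2 * π) = lap φ p := fun p =>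
    congrArg₂ (· + ·) (pd1_periodic_snd (pd1_periodic_snd hper2) p)
      (pd2_periodic_snd (pd2_periodic_snd hper2) p)
  set a := Real.sqrt (∫ p in cell2, (φ p) ^ 2) with ha
  set b := Real.sqrt (∫ p in cell2, (lap φ p) ^ 2) with hb
  have ha2 : a ^ 2 = ∫ p in cell2, (φ p) ^ 2 :=
    Real.sq_sqrt (integral_nonneg fun p => sq_nonneg _)
  have hb2 : b ^ 2 = ∫ p in cell2, (lap φ p) ^ 2 :=
    Real.sq_sqrt (integral_nonneg fun p => sq_nonneg _)
  have hA := hasSum_sq_doubleFourierCoeff hsmooth.continuous hper1 hper2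
  have hB := hasSum_sq_doubleFourierCoeff hlap.continuous hlap1 hlap2
  rw [← ha2, show (4 * π ^ 2)⁻¹ * a ^ 2 = (a / (2 * π)) ^ 2 by field_simp; ring] at hA
  rw [← hb2, show (4 * π ^ 2)⁻¹ * b ^ 2 = (b / (2 * π)) ^ 2 by field_simp; ring] at hB
  have hB' : HasSum (fun k => (freqSq k * ‖doubleFourierCoeff φ k‖) ^ 2) ((b / (2 * π)) ^ 2) := by
    refine hB.congr_fun fun k => ?_
    rw [doubleFourierCoeff_lap hsmooth hper1 hper2, norm_mul, norm_neg, Complex.norm_real,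
      mul_pow, mul_pow, norm_eq_abs, sq_abs]
  have hR : 0 ≤ (1 / π) * a * b := by positivity
  have hsum : ∀ s : Finset (Fin 2 → ℤ),
      ∑ k ∈ s, ‖doubleFourierCoeff φ k‖ ≤ Real.sqrt ((1 / π) * a * b) := fun s => by
    refine Real.le_sqrt_of_sq_le ((sum_norm_sq_le
      (doubleFourierCoeff_zero hsmooth.continuous hmean) hA hB' (by positivity) (by positivity)
      s).trans_eq ?_)
    field_simp
    ring
  have hsup : (⨆ p ∈ cell2, |φ p|) ≤ Real.sqrt ((1 / π) * a * b) :=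
    Real.iSup_le (fun p => Real.iSup_le (fun _ =>
      abs_le_of_sum_doubleFourierCoeff_le hsmooth.continuous hper1 hper2 hsum p)
      (Real.sqrt_nonneg _)) (Real.sqrt_nonneg _)
  have hsup0 : 0 ≤ ⨆ p ∈ cell2, |φ p| :=
    Real.iSup_nonneg fun p => Real.iSup_nonneg fun _ => abs_nonneg _
  calc (⨆ p ∈ cell2, |φ p|) ^ 2 ≤ Real.sqrt ((1 / π) * a * b) ^ 2 := by gcongr
    _ = (1 / π) * a * b := Real.sq_sqrt hR
end

section
/- Let φ : ℝ² → ℝ be a smooth function, 2π-periodic in each variable, with mean value zero over T² = [0,2π]². Then for every ν > 0, ‖φ‖_∞² ≤ (1/(4π²)) · (∑_{k ∈ ℤ²\{0}} 1/(1 + ν|k|⁴)) · (‖φ‖² + ν‖Δφ‖²), where |k|² = k₁² + k₂². -/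
open MeasureTheory Real

/-- The function on the unit torus induced by a function on `ℝ²` that is `2π`-periodic in each
variable. -/
noncomputable def torusLift (g : ℝ × ℝ → ℝ) (x : UnitAddTorus (Fin 2)) : ℂ :=
  (g (2 * π * AddCircle.equivIco 1 0 (x 0), 2 * π * AddCircle.equivIco 1 0 (x 1)) : ℂ)

/-- Smooth functions on `ℝ²` that are `2π`-periodic in each variable. -/
structure IsSmoothPeriodic (g : ℝ × ℝ → ℝ) : Prop where
  contDiff : ContDiff ℝ (⊤ : ℕ∞) g
  periodic_fst : ∀ y, Function.Periodic (fun x => g (x, y)) (2 * π)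
  periodic_snd : ∀ x, Function.Periodic (fun y => g (x, y)) (2 * π)

lemma two_pi_mul_equivIco (s : ℝ) :
    2 * π * (AddCircle.equivIco 1 0 ((s : ℝ) : UnitAddCircle) : ℝ)
      = 2 * π * s - (⌊s⌋ : ℤ) * (2 * π) := by
  have h := AddCircle.coe_equivIco_mk_apply (1 : ℝ) s
  rw [div_one, mul_one] at h
  have h' : (AddCircle.equivIco 1 0 ((s : ℝ) : UnitAddCircle) : ℝ) = Int.fract s := h
  rw [h', Int.fract]
  ring

lemma torusLift_coe {g : ℝ × ℝ → ℝ} (hg : IsSmoothPeriodic g) (s t : ℝ)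
    (x : UnitAddTorus (Fin 2)) (h0 : x 0 = (s : UnitAddCircle)) (h1 : x 1 = (t : UnitAddCircle)) :
    torusLift g x = (g (2 * π * s, 2 * π * t) : ℂ) := by
  rw [torusLift, h0, h1, two_pi_mul_equivIco, two_pi_mul_equivIco]
  have e1 := (hg.periodic_fst (2 * π * t - (⌊t⌋ : ℤ) * (2 * π))).sub_int_mul_eq
    (x := 2 * π * s) ⌊s⌋
  have e2 := (hg.periodic_snd (2 * π * s)).sub_int_mul_eq (x := 2 * π * t) ⌊t⌋
  exact congrArg _ (e1.trans e2)

lemma continuous_torusLift {g : ℝ × ℝ → ℝ} (hg : IsSmoothPeriodic g) :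
    Continuous (torusLift g) := by
  have hq : IsOpenQuotientMap
      (Pi.map (fun _ : Fin 2 => ((↑) : ℝ → UnitAddCircle))) :=
    IsOpenQuotientMap.piMap fun _ => QuotientAddGroup.isOpenQuotientMap_mk
  rw [← hq.continuous_comp_iff]
  have : torusLift g ∘ Pi.map (fun _ : Fin 2 => ((↑) : ℝ → UnitAddCircle))
      = fun v => (g (2 * π * v 0, 2 * π * v 1) : ℂ) := by
    funext v
    exact torusLift_coe hg _ _ _ rfl rfl
  rw [this]
  have := hg.contDiff.continuous
  fun_prop

/-- Integrals over the unit square of `Fin 2 → ℝ` as iterated integrals. -/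
lemma setIntegral_fin_two_unit_square {E : Type*} [NormedAddCommGroup E] [NormedSpace ℝ E]
    {h : ℝ × ℝ → E} (hh : Continuous h) :
    ∫ v : Fin 2 → ℝ in {v | ∀ i, v i ∈ Set.Ioc (0 : ℝ) (0 + 1)}, h (v 0, v 1)
      = ∫ s in (0 : ℝ)..1, ∫ t in (0 : ℝ)..1, h (s, t) := by
  have e := (volume_preserving_finTwoArrow ℝ).setIntegral_preimage_emb
    MeasurableEquiv.finTwoArrow.measurableEmbedding h (Set.Ioc (0 : ℝ) 1 ×ˢ Set.Ioc (0 : ℝ) 1)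
  have hs : (MeasurableEquiv.finTwoArrow (α := ℝ)) ⁻¹' (Set.Ioc (0 : ℝ) 1 ×ˢ Set.Ioc (0 : ℝ) 1)
      = {v | ∀ i, v i ∈ Set.Ioc (0 : ℝ) (0 + 1)} := by
    ext v
    simp [Fin.forall_fin_two, MeasurableEquiv.finTwoArrow]
  rw [hs] at e
  refine e.trans ?_
  rw [Measure.volume_eq_prod, setIntegral_prod]
  · simp only [intervalIntegral.integral_of_le zero_le_one]
  · rw [← Measure.volume_eq_prod]
    exact (hh.continuousOn.integrableOn_compact (isCompact_Icc.prod isCompact_Icc)).mono_set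
      (Set.prod_mono Set.Ioc_subset_Icc_self Set.Ioc_subset_Icc_self)

lemma intervalIntegral_unit_square_swap {E : Type*} [NormedAddCommGroup E] [NormedSpace ℝ E]
    {h : ℝ × ℝ → E} (hh : Continuous h) :
    ∫ s in (0 : ℝ)..1, ∫ t in (0 : ℝ)..1, h (s, t)
      = ∫ t in (0 : ℝ)..1, ∫ s in (0 : ℝ)..1, h (s, t) := by
  simp only [intervalIntegral.integral_of_le zero_le_one]
  refine integral_integral_swap (f := fun s t => h (s, t)) ?_
  have : IntegrableOn h (Set.Ioc (0 : ℝ) 1 ×ˢ Set.Ioc (0 : ℝ) 1) (volume.prod volume) := by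
    rw [← Measure.volume_eq_prod]
    exact (hh.continuousOn.integrableOn_compact (isCompact_Icc.prod isCompact_Icc)).mono_set
      (Set.prod_mono Set.Ioc_subset_Icc_self Set.Ioc_subset_Icc_self)
  rwa [IntegrableOn, ← Measure.prod_restrict] at this

lemma setIntegral_cell2 {h : ℝ × ℝ → ℝ} (hh : Continuous h) :
    ∫ p in cell2, h p
      = 4 * π ^ 2 * ∫ s in (0 : ℝ)..1, ∫ t in (0 : ℝ)..1, h (2 * π * s, 2 * π * t) := by
  have hpi : 2 * π ≠ 0 := by positivity
  have hpi0 : 0 ≤ 2 * π := by positivity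
  rw [cell2, Measure.volume_eq_prod, setIntegral_prod]
  · have h1 (x : ℝ) : ∫ t in (0 : ℝ)..1, h (x, 2 * π * t)
        = (2 * π)⁻¹ * ∫ y in (0 : ℝ)..(2 * π), h (x, y) := by
      rw [intervalIntegral.integral_comp_mul_left (fun y => h (x, y)) hpi]
      simp
    simp only [h1]
    rw [intervalIntegral.integral_comp_mul_left
      (fun x => (2 * π)⁻¹ * ∫ y in (0 : ℝ)..(2 * π), h (x, y)) hpi,
      intervalIntegral.integral_const_mul]
    simp only [intervalIntegral.integral_of_le hpi0, integral_Icc_eq_integral_Ioc, mul_zero,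
      mul_one, smul_eq_mul]
    field_simp
    ring
  · rw [← Measure.volume_eq_prod]
    exact hh.continuousOn.integrableOn_compact (isCompact_Icc.prod isCompact_Icc)

attribute [local instance] instMeasureSpaceUnitAddCircle

local instance isProbabilityMeasure_unitAddCircle :
    IsProbabilityMeasure (volume : Measure UnitAddCircle) :=
  inferInstanceAs (IsProbabilityMeasure AddCircle.haarAddCircle)

lemma mFourierCoeff_torusLift {g : ℝ × ℝ → ℝ} (hg : IsSmoothPeriodic g) (n : Fin 2 → ℤ) :
    UnitAddTorus.mFourierCoeff (torusLift g) n = ∫ s in (0 : ℝ)..1, ∫ t in (0 : ℝ)..1,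
      Complex.exp (-(2 * π * Complex.I * n 0) * s) * Complex.exp (-(2 * π * Complex.I * n 1) * t)
        * (g (2 * π * s, 2 * π * t) : ℂ) := by
  have hc := hg.contDiff.continuous
  rw [UnitAddTorus.mFourierCoeff_eq_integral _ _ 0, ← setIntegral_fin_two_unit_square
    (h := fun p : ℝ × ℝ => Complex.exp (-(2 * π * Complex.I * n 0) * p.1) *
      Complex.exp (-(2 * π * Complex.I * n 1) * p.2) * (g (2 * π * p.1, 2 * π * p.2) : ℂ))
    (by fun_prop)]
  congr 1
  funext v
  rw [torusLift_coe hg (v 0) (v 1) _ rfl rfl]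
  simp only [UnitAddTorus.mFourier, ContinuousMap.coe_mk, Fin.prod_univ_two, fourier_coe_apply,
    Pi.neg_apply, smul_eq_mul]
  congr 3 <;> push_cast <;> ring

lemma hasSum_sq_mFourierCoeff_torusLift {g : ℝ × ℝ → ℝ} (hg : IsSmoothPeriodic g) :
    HasSum (fun n => ‖UnitAddTorus.mFourierCoeff (torusLift g) n‖ ^ 2)
      (1 / (4 * π ^ 2) * ∫ p in cell2, g p ^ 2) := by
  have hc := hg.contDiff.continuous
  let F : C(UnitAddTorus (Fin 2), ℂ) := ⟨torusLift g, continuous_torusLift hg⟩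
  have key := UnitAddTorus.hasSum_sq_mFourierCoeff (F.toLp 2 volume ℂ)
  simp only [UnitAddTorus.mFourierCoeff_toLp] at key
  have e1 : ∫ x, ‖F.toLp 2 volume ℂ x‖ ^ 2 = ∫ x, ‖torusLift g x‖ ^ 2 := by
    refine integral_congr_ae ?_
    filter_upwards [F.coeFn_toLp (p := 2) (𝕜 := ℂ) volume] with x hx
    rw [hx]
    rfl
  rw [e1, UnitAddTorus.integral_preimage _ 0] at key
  convert key using 1
  · rfl
  · rw [setIntegral_cell2 (by fun_prop), ← setIntegral_fin_two_unit_square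
      (h := fun p : ℝ × ℝ => g (2 * π * p.1, 2 * π * p.2) ^ 2) (by fun_prop), ← mul_assoc,
      one_div, inv_mul_cancel₀ (by positivity), one_mul]
    congr 1
    funext v
    rw [torusLift_coe hg (v 0) (v 1) _ rfl rfl]
    simp

lemma IsSmoothPeriodic.hasDerivAt_fst {g : ℝ × ℝ → ℝ} (hg : IsSmoothPeriodic g) (x y : ℝ) :
    HasDerivAt (fun s => g (s, y)) (pd1 g (x, y)) x := by
  have : Differentiable ℝ (fun s => g (s, y)) :=
    (hg.contDiff.differentiable (by simp)).comp (by fun_prop)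
  exact (this x).hasDerivAt

lemma IsSmoothPeriodic.hasDerivAt_snd {g : ℝ × ℝ → ℝ} (hg : IsSmoothPeriodic g) (x y : ℝ) :
    HasDerivAt (fun t => g (x, t)) (pd2 g (x, y)) y := by
  have : Differentiable ℝ (fun t => g (x, t)) :=
    (hg.contDiff.differentiable (by simp)).comp (by fun_prop)
  exact (this y).hasDerivAt

lemma IsSmoothPeriodic.pd1 {g : ℝ × ℝ → ℝ} (hg : IsSmoothPeriodic g) :
    IsSmoothPeriodic (pd1 g) where
  contDiff := by
    have e : _root_.pd1 g = fun p => fderiv ℝ g p (1, 0) := by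
      funext ⟨x, y⟩
      refine (hg.hasDerivAt_fst x y).unique ?_
      exact ((hg.contDiff.differentiable (by simp)) (x, y)).hasFDerivAt.comp_hasDerivAt x
        ((hasDerivAt_id x).prodMk (hasDerivAt_const x y))
    rw [e]
    exact (hg.contDiff.fderiv_right (m := (⊤ : ℕ∞)) (by simp)).clm_apply contDiff_const
  periodic_fst y x := by
    change deriv (fun s => g (s, y)) (x + 2 * π) = deriv (fun s => g (s, y)) x
    rw [← deriv_comp_add_const]
    exact congrArg (deriv · x) (funext (hg.periodic_fst y))
  periodic_snd x y := by
    change deriv (fun s => g (s, y + 2 * π)) x = deriv (fun s => g (s, y)) x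
    exact congrArg (deriv · x) (funext fun s => hg.periodic_snd s y)

lemma IsSmoothPeriodic.pd2 {g : ℝ × ℝ → ℝ} (hg : IsSmoothPeriodic g) :
    IsSmoothPeriodic (pd2 g) where
  contDiff := by
    have e : _root_.pd2 g = fun p => fderiv ℝ g p (0, 1) := by
      funext ⟨x, y⟩
      refine (hg.hasDerivAt_snd x y).unique ?_
      exact ((hg.contDiff.differentiable (by simp)) (x, y)).hasFDerivAt.comp_hasDerivAt y
        ((hasDerivAt_const y x).prodMk (hasDerivAt_id y))
    rw [e]
    exact (hg.contDiff.fderiv_right (m := (⊤ : ℕ∞)) (by simp)).clm_apply contDiff_const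
  periodic_fst y x := by
    change deriv (fun s => g (x + 2 * π, s)) y = deriv (fun s => g (x, s)) y
    exact congrArg (deriv · y) (funext fun s => hg.periodic_fst s x)
  periodic_snd x y := by
    change deriv (fun s => g (x, s)) (y + 2 * π) = deriv (fun s => g (x, s)) y
    rw [← deriv_comp_add_const]
    exact congrArg (deriv · y) (funext (hg.periodic_snd x))

lemma IsSmoothPeriodic.add {g h : ℝ × ℝ → ℝ} (hg : IsSmoothPeriodic g)
    (hh : IsSmoothPeriodic h) : IsSmoothPeriodic (fun p => g p + h p) where
  contDiff := hg.contDiff.add hh.contDiff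
  periodic_fst y x := congrArg₂ (· + ·) (hg.periodic_fst y x) (hh.periodic_fst y x)
  periodic_snd x y := congrArg₂ (· + ·) (hg.periodic_snd x y) (hh.periodic_snd x y)

lemma IsSmoothPeriodic.lap {g : ℝ × ℝ → ℝ} (hg : IsSmoothPeriodic g) :
    IsSmoothPeriodic (lap g) :=
  hg.pd1.pd1.add hg.pd2.pd2

/-- Integration by parts against a character, for a periodic function. -/
lemma integral_exp_mul_deriv_of_periodic {G G' : ℝ → ℝ} (hG : ∀ x, HasDerivAt G (G' x) x)
    (hG' : Continuous G') (hper : Function.Periodic G (2 * π)) (n : ℤ) :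
    ∫ t in (0 : ℝ)..1, Complex.exp (-(2 * π * Complex.I * n) * t) * (G' (2 * π * t) : ℂ)
      = Complex.I * n *
        ∫ t in (0 : ℝ)..1, Complex.exp (-(2 * π * Complex.I * n) * t) * (G (2 * π * t) : ℂ) := by
  have hpi : (π : ℂ) ≠ 0 := by exact_mod_cast Real.pi_ne_zero
  have hu (t : ℝ) : HasDerivAt (fun t : ℝ => Complex.exp (-(2 * π * Complex.I * n) * t))
      (Complex.exp (-(2 * π * Complex.I * n) * t) * (-(2 * π * Complex.I * n))) t := by
    have h := ((hasDerivAt_id (t : ℂ)).const_mul (-(2 * π * Complex.I * n))).cexp.comp_ofReal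
    simpa using h
  have hv (t : ℝ) : HasDerivAt (fun t : ℝ => (G (2 * π * t) : ℂ) / (2 * π))
      (G' (2 * π * t) : ℂ) t := by
    have h1 : HasDerivAt (fun t : ℝ => 2 * π * t) (2 * π) t := by
      simpa using (hasDerivAt_id t).const_mul (2 * π)
    have h := ((hG (2 * π * t)).comp t h1).ofReal_comp.div_const (2 * π : ℂ)
    have e : ((G' (2 * π * t) * (2 * π) : ℝ) : ℂ) / (2 * π) = (G' (2 * π * t) : ℂ) := by
      push_cast
      field_simp
    exact e ▸ h
  rw [intervalIntegral.integral_mul_deriv_eq_deriv_mul (fun t _ => hu t) (fun t _ => hv t)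
    ((by fun_prop : Continuous fun t : ℝ => Complex.exp (-(2 * π * Complex.I * n) * t) *
      (-(2 * π * Complex.I * n))).intervalIntegrable _ _)
    ((by fun_prop : Continuous fun t : ℝ => (G' (2 * π * t) : ℂ)).intervalIntegrable _ _)]
  have hexp : Complex.exp (-(2 * π * Complex.I * n) * (1 : ℝ)) = 1 := by
    rw [Complex.exp_eq_one_iff]
    exact ⟨-n, by push_cast; ring⟩
  have hb : G (2 * π * 1) = G (2 * π * 0) := by
    have := hper 0
    simpa using this
  rw [hexp, hb, ← intervalIntegral.integral_const_mul]
  simp only [Complex.ofReal_zero, mul_zero, Complex.exp_zero, sub_self, zero_sub]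
  rw [← intervalIntegral.integral_neg]
  congr 1
  funext t
  field_simp

lemma mFourierCoeff_pd2 {g : ℝ × ℝ → ℝ} (hg : IsSmoothPeriodic g) (n : Fin 2 → ℤ) :
    UnitAddTorus.mFourierCoeff (torusLift (pd2 g)) n
      = Complex.I * n 1 * UnitAddTorus.mFourierCoeff (torusLift g) n := by
  rw [mFourierCoeff_torusLift hg, mFourierCoeff_torusLift hg.pd2,
    ← intervalIntegral.integral_const_mul]
  congr 1
  funext s
  have hc := hg.pd2.contDiff.continuous
  have h := integral_exp_mul_deriv_of_periodic (fun y => hg.hasDerivAt_snd (2 * π * s) y)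
    (by fun_prop) (hg.periodic_snd _) (n 1)
  simp only [mul_assoc (Complex.exp (_ * (s : ℂ))), intervalIntegral.integral_const_mul]
  rw [h]
  ring

lemma mFourierCoeff_pd1 {g : ℝ × ℝ → ℝ} (hg : IsSmoothPeriodic g) (n : Fin 2 → ℤ) :
    UnitAddTorus.mFourierCoeff (torusLift (pd1 g)) n
      = Complex.I * n 0 * UnitAddTorus.mFourierCoeff (torusLift g) n := by
  have hc := hg.pd1.contDiff.continuous
  have hc' := hg.contDiff.continuous
  have swap {f : ℝ × ℝ → ℝ} (hf : Continuous f) := intervalIntegral_unit_square_swap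
    (h := fun p : ℝ × ℝ => Complex.exp (-(2 * π * Complex.I * n 0) * p.1) *
      Complex.exp (-(2 * π * Complex.I * n 1) * p.2) * (f (2 * π * p.1, 2 * π * p.2) : ℂ))
    (by fun_prop)
  rw [mFourierCoeff_torusLift hg, mFourierCoeff_torusLift hg.pd1, swap hc, swap hc',
    ← intervalIntegral.integral_const_mul]
  congr 1
  funext t
  have h := integral_exp_mul_deriv_of_periodic (fun x => hg.hasDerivAt_fst x (2 * π * t))
    (by fun_prop) (hg.periodic_fst _) (n 0)
  simp only [mul_right_comm _ (Complex.exp (_ * (t : ℂ))), intervalIntegral.integral_mul_const]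
  rw [h]
  ring

lemma mFourierCoeff_lap {g : ℝ × ℝ → ℝ} (hg : IsSmoothPeriodic g) (n : Fin 2 → ℤ) :
    UnitAddTorus.mFourierCoeff (torusLift (lap g)) n
      = -((n 0 : ℂ) ^ 2 + (n 1 : ℂ) ^ 2) * UnitAddTorus.mFourierCoeff (torusLift g) n := by
  have hadd : UnitAddTorus.mFourierCoeff (torusLift (lap g)) n
      = UnitAddTorus.mFourierCoeff (torusLift (pd1 (pd1 g))) n
        + UnitAddTorus.mFourierCoeff (torusLift (pd2 (pd2 g))) n := by
    have c1 := continuous_torusLift hg.pd1.pd1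
    have c2 := continuous_torusLift hg.pd2.pd2
    rw [UnitAddTorus.mFourierCoeff, UnitAddTorus.mFourierCoeff, UnitAddTorus.mFourierCoeff,
      ← integral_add]
    · congr 1
      funext x
      simp [torusLift, lap, mul_add]
    · exact Continuous.integrable_of_hasCompactSupport (by fun_prop)
        (HasCompactSupport.of_compactSpace _)
    · exact Continuous.integrable_of_hasCompactSupport (by fun_prop)
        (HasCompactSupport.of_compactSpace _)
  rw [hadd, mFourierCoeff_pd1 hg.pd1, mFourierCoeff_pd1 hg, mFourierCoeff_pd2 hg.pd2,
    mFourierCoeff_pd2 hg]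
  linear_combination (((n 0 : ℂ) ^ 2 + (n 1 : ℂ) ^ 2) *
    UnitAddTorus.mFourierCoeff (torusLift g) n) * Complex.I_sq

/-- Cauchy–Schwarz inequality for series of nonnegative reals. -/
lemma summable_and_sq_tsum_mul_le {ι : Type*} {a b : ι → ℝ} (ha : ∀ i, 0 ≤ a i)
    (hb : ∀ i, 0 ≤ b i) (hsa : Summable fun i => a i ^ 2) (hsb : Summable fun i => b i ^ 2) :
    (Summable fun i => a i * b i) ∧
      (∑' i, a i * b i) ^ 2 ≤ (∑' i, a i ^ 2) * ∑' i, b i ^ 2 := by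
  obtain ⟨h1, h2⟩ := Real.summable_and_inner_le_Lp_mul_Lq_tsum_of_nonneg
    (p := 2) (q := 2) Real.HolderConjugate.two_two ha hb (by simpa using hsa) (by simpa using hsb)
  refine ⟨h1, ?_⟩
  simp only [Real.rpow_two, ← Real.sqrt_eq_rpow] at h2
  have h0 : 0 ≤ ∑' i, a i * b i := tsum_nonneg fun i => mul_nonneg (ha i) (hb i)
  calc (∑' i, a i * b i) ^ 2 ≤ (√(∑' i, a i ^ 2) * √(∑' i, b i ^ 2)) ^ 2 := by gcongr
    _ = _ := by
      rw [mul_pow, Real.sq_sqrt (tsum_nonneg fun i => sq_nonneg _),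
        Real.sq_sqrt (tsum_nonneg fun i => sq_nonneg _)]

lemma summable_agmon_weight {ν : ℝ} (hν : 0 < ν) :
    Summable fun n : Fin 2 → ℤ => if n = 0 then (0 : ℝ) else
      1 / (1 + ν * ((n 0 : ℝ) ^ 2 + (n 1 : ℝ) ^ 2) ^ 2) := by
  have hs := (EisensteinSeries.summable_one_div_norm_rpow (k := 4) (by norm_num)).mul_left ν⁻¹
  refine Summable.of_nonneg_of_le (fun n => ?_) (fun n => ?_) hs
  · split_ifs <;> positivity
  · split_ifs with hn
    · positivity
    · have hpos : 0 < ‖n‖ := norm_pos_iff.mpr hn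
      have hle : ‖n‖ ^ 2 ≤ (n 0 : ℝ) ^ 2 + (n 1 : ℝ) ^ 2 := by
        have : ‖n‖ ≤ √((n 0 : ℝ) ^ 2 + (n 1 : ℝ) ^ 2) := by
          rw [pi_norm_le_iff_of_nonneg (Real.sqrt_nonneg _), Fin.forall_fin_two]
          constructor <;> rw [Int.norm_eq_abs] <;> apply Real.abs_le_sqrt <;>
            nlinarith [sq_nonneg (n 0 : ℝ), sq_nonneg (n 1 : ℝ)]
        calc ‖n‖ ^ 2 ≤ √((n 0 : ℝ) ^ 2 + (n 1 : ℝ) ^ 2) ^ 2 := by gcongr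
          _ = _ := Real.sq_sqrt (by positivity)
      have h4 : ‖n‖ ^ (-4 : ℝ) = (‖n‖ ^ 4)⁻¹ := by
        rw [Real.rpow_neg hpos.le]
        norm_cast
      rw [h4, ← mul_inv, one_div]
      gcongr
      calc ν * ‖n‖ ^ 4 = ν * (‖n‖ ^ 2) ^ 2 := by ring
        _ ≤ ν * ((n 0 : ℝ) ^ 2 + (n 1 : ℝ) ^ 2) ^ 2 := by gcongr
        _ ≤ _ := by linarith

lemma sq_le_of_isSmoothPeriodic {φ : ℝ × ℝ → ℝ} (hφ : IsSmoothPeriodic φ)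
    (hmean : (∫ p in cell2, φ p) = 0) {ν : ℝ} (hν : 0 < ν) (p : ℝ × ℝ) :
    φ p ^ 2 ≤ (1 / (4 * π ^ 2)) *
        (∑' k : ℤ × ℤ, if k = 0 then 0 else
          1 / (1 + ν * ((k.1 : ℝ) ^ 2 + (k.2 : ℝ) ^ 2) ^ 2)) *
        ((∫ p in cell2, (φ p) ^ 2) + ν * ∫ p in cell2, (lap φ p) ^ 2) := by
  set c : (Fin 2 → ℤ) → ℂ := UnitAddTorus.mFourierCoeff (torusLift φ) with hc_def
  let w : (Fin 2 → ℤ) → ℝ := fun n => 1 + ν * ((n 0 : ℝ) ^ 2 + (n 1 : ℝ) ^ 2) ^ 2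
  have hw (n) : 0 < w n := by positivity
  have hc0 : c 0 = 0 := by
    have hm := setIntegral_cell2 hφ.contDiff.continuous
    rw [hmean] at hm
    have hz := (mul_eq_zero.mp hm.symm).resolve_left (by positivity)
    rw [hc_def, mFourierCoeff_torusLift hφ]
    simp [intervalIntegral.integral_ofReal, hz]
  have hsum : HasSum (fun n => w n * ‖c n‖ ^ 2) (1 / (4 * π ^ 2) *
      ((∫ p in cell2, (φ p) ^ 2) + ν * ∫ p in cell2, (lap φ p) ^ 2)) := by
    convert (hasSum_sq_mFourierCoeff_torusLift hφ).add
      ((hasSum_sq_mFourierCoeff_torusLift hφ.lap).mul_left ν) using 1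
    · funext n
      have hn : ‖-((n 0 : ℂ) ^ 2 + (n 1 : ℂ) ^ 2)‖ = (n 0 : ℝ) ^ 2 + (n 1 : ℝ) ^ 2 := by
        rw [norm_neg]
        have : ((n 0 : ℂ) ^ 2 + (n 1 : ℂ) ^ 2) = (((n 0 : ℝ) ^ 2 + (n 1 : ℝ) ^ 2 : ℝ) : ℂ) := by
          push_cast
          rfl
        rw [this, Complex.norm_real, Real.norm_of_nonneg (by positivity)]
      rw [mFourierCoeff_lap hφ, norm_mul, hn]
      ring
    · ring
  let a : (Fin 2 → ℤ) → ℝ := fun n => if n = 0 then 0 else √(1 / w n)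
  let b : (Fin 2 → ℤ) → ℝ := fun n => √(w n) * ‖c n‖
  have hb2 : (fun n => b n ^ 2) = fun n => w n * ‖c n‖ ^ 2 := by
    funext n
    rw [mul_pow, Real.sq_sqrt (hw n).le]
  have ha2 : (fun n => a n ^ 2) = fun n => if n = 0 then (0 : ℝ) else 1 / w n := by
    funext n
    by_cases hn : n = 0
    · simp [a, hn]
    · simp only [a, hn, if_false]
      exact Real.sq_sqrt (one_div_pos.mpr (hw n)).le
  have hab : (fun n => a n * b n) = fun n => ‖c n‖ := by
    funext n
    by_cases hn : n = 0
    · simp [a, hn, hc0]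
    · simp only [a, b, hn, if_false]
      rw [← mul_assoc, ← Real.sqrt_mul (one_div_pos.mpr (hw n)).le, one_div,
        inv_mul_cancel₀ (hw n).ne', Real.sqrt_one, one_mul]
  obtain ⟨hs, hle⟩ := summable_and_sq_tsum_mul_le (a := a) (b := b)
    (fun n => by dsimp only [a]; split_ifs <;> positivity) (fun n => by positivity)
    (by rw [ha2]; exact summable_agmon_weight hν) (by rw [hb2]; exact hsum.summable)
  rw [hab] at hs hle
  rw [ha2, hb2, hsum.tsum_eq] at hle
  have hS : ∑' k : ℤ × ℤ, (if k = 0 then (0 : ℝ) else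
      1 / (1 + ν * ((k.1 : ℝ) ^ 2 + (k.2 : ℝ) ^ 2) ^ 2))
      = ∑' n : Fin 2 → ℤ, if n = 0 then (0 : ℝ) else 1 / w n := by
    rw [← (finTwoArrowEquiv ℤ).tsum_eq]
    refine tsum_congr fun n => ?_
    have : finTwoArrowEquiv ℤ n = 0 ↔ n = 0 := by
      simp [funext_iff, Fin.forall_fin_two, Prod.ext_iff]
    simp only [this]
    rfl
  have hpt : |φ p| ≤ ∑' n, ‖c n‖ := by
    let F : C(UnitAddTorus (Fin 2), ℂ) := ⟨torusLift φ, continuous_torusLift hφ⟩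
    let x : UnitAddTorus (Fin 2) :=
      ![((p.1 / (2 * π) : ℝ) : UnitAddCircle), ((p.2 / (2 * π) : ℝ) : UnitAddCircle)]
    have hF := UnitAddTorus.hasSum_mFourier_series_apply_of_summable (f := F) hs.of_norm x
    have hFx : F x = (φ p : ℂ) := by
      change torusLift φ x = _
      rw [torusLift_coe hφ (p.1 / (2 * π)) (p.2 / (2 * π)) x rfl rfl,
        mul_div_cancel₀ _ (by positivity), mul_div_cancel₀ _ (by positivity)]
    rw [hFx] at hF
    have hbound (n) : ‖UnitAddTorus.mFourierCoeff F n • UnitAddTorus.mFourier n x‖ ≤ ‖c n‖ := by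
      rw [norm_smul]
      refine mul_le_of_le_one_right (norm_nonneg _) ?_
      exact ((UnitAddTorus.mFourier n).norm_coe_le_norm x).trans UnitAddTorus.mFourier_norm.le
    have := tsum_of_norm_bounded hs.hasSum hbound
    rwa [hF.tsum_eq, Complex.norm_real, Real.norm_eq_abs] at this
  calc φ p ^ 2 = |φ p| ^ 2 := (sq_abs _).symm
    _ ≤ (∑' n, ‖c n‖) ^ 2 := by gcongr
    _ ≤ _ := hle
    _ = _ := by rw [hS]; ring

/-- Parametric Agmon inequality on the square torus: for every `ν > 0`,
`‖φ‖_∞² ≤ (1/(4π²)) (∑_{k ∈ ℤ²∖{0}} 1/(1+ν|k|⁴)) (‖φ‖² + ν‖Δφ‖²)`. -/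
theorem agmon_parametric_square_torus
    (φ : ℝ × ℝ → ℝ)
    (hsmooth : ContDiff ℝ (⊤ : ℕ∞) φ)
    (hper1 : ∀ p : ℝ × ℝ, φ (p.1 + 2 * π, p.2) = φ p)
    (hper2 : ∀ p : ℝ × ℝ, φ (p.1, p.2 + 2 * π) = φ p)
    (hmean : (∫ p in cell2, φ p) = 0)
    (ν : ℝ) (hν : 0 < ν) :
    (⨆ p ∈ cell2, |φ p|) ^ 2 ≤
      (1 / (4 * π ^ 2)) *
        (∑' k : ℤ × ℤ, if k = 0 then 0 else
          1 / (1 + ν * ((k.1 : ℝ) ^ 2 + (k.2 : ℝ) ^ 2) ^ 2)) *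
        ((∫ p in cell2, (φ p) ^ 2) + ν * ∫ p in cell2, (lap φ p) ^ 2) := by
  have hφ : IsSmoothPeriodic φ :=
    ⟨hsmooth, fun y x => hper1 (x, y), fun x y => hper2 (x, y)⟩
  set R := (1 / (4 * π ^ 2)) *
        (∑' k : ℤ × ℤ, if k = 0 then 0 else
          1 / (1 + ν * ((k.1 : ℝ) ^ 2 + (k.2 : ℝ) ^ 2) ^ 2)) *
        ((∫ p in cell2, (φ p) ^ 2) + ν * ∫ p in cell2, (lap φ p) ^ 2)
  have hpt (p : ℝ × ℝ) : φ p ^ 2 ≤ R := sq_le_of_isSmoothPeriodic hφ hmean hν p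
  have hR : 0 ≤ R := (sq_nonneg _).trans (hpt 0)
  have hsup : (⨆ p ∈ cell2, |φ p|) ≤ √R :=
    Real.iSup_le (fun p => Real.iSup_le (fun _ => Real.abs_le_sqrt (hpt p)) (Real.sqrt_nonneg _))
      (Real.sqrt_nonneg _)
  have h0 : 0 ≤ ⨆ p ∈ cell2, |φ p| :=
    Real.iSup_nonneg fun p => Real.iSup_nonneg fun _ => abs_nonneg _
  calc (⨆ p ∈ cell2, |φ p|) ^ 2 ≤ √R ^ 2 := by gcongr
    _ = R := Real.sq_sqrt hR
end
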